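/- Let R be a commutative ring containing the field of rational numbers, let φ : R^m → R^n be an R-linear map, and let 1 ≤ d ≤ n. Then I(⋀^d(φ)) = I(φ)^e, where e = binomial(n-1, d-1). -/

import Mathlib

noncomputable section

/-- `I_t(A)`: the ideal of `R` generated by the `t × t` minors of the matrix `A`. -/
def minorsIdeal {R : Type*} [CommRing R] (t : ℕ) {N M : Type*} (A : Matrix N M R) : Ideal R :=
  Ideal.span {x : R | ∃ (r : Fin t → N) (c : Fin t → M), x = (A.submatrix r c).det}

/-- The matrix (in the standard bases) of the `d`-th exterior power
`⋀^d(φ) : ⋀^d(R^m) → ⋀^d(R^n)` of the linear map `φ : R^m → R^n` given by the `n × m`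
matrix `A`: rows and columns are indexed by `d`-element subsets, and the entries are the
corresponding `d × d` minors of `A`. -/
def extPowMatrix {R : Type*} [CommRing R] {m n : ℕ} (d : ℕ) (A : Matrix (Fin n) (Fin m) R) :
    Matrix {s : Finset (Fin n) // s.card = d} {s : Finset (Fin m) // s.card = d} R :=
  fun S T => (A.submatrix (S.1.orderEmbOfFin S.2) (T.1.orderEmbOfFin T.2)).det

open scoped TensorProduct

/-- A form of the Cauchy–Binet formula, summed over all functions instead of all subsets. -/
theorem factorial_mul_det_mul_transpose {S ι κ : Type*} [CommRing S] [Fintype ι] [DecidableEq ι]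
    [Fintype κ] (A B : Matrix ι κ S) :
    ((Fintype.card ι).factorial : S) * (A * B.transpose).det =
      ∑ c : ι → κ, (A.submatrix id c).det * (B.submatrix id c).det := by
  classical
  have h : (A * B.transpose).det = ∑ c : ι → κ, (A.submatrix id c).det * ∏ i, B i (c i) := by
    simp only [Matrix.det_apply', Matrix.mul_apply, Matrix.transpose_apply, Finset.prod_univ_sum,
      Fintype.piFinset_univ, Finset.mul_sum, Finset.sum_mul, Matrix.submatrix_apply, id]
    rw [Finset.sum_comm]
    simp only [Finset.prod_mul_distrib, mul_assoc]
  have hσ (σ : Equiv.Perm ι) : (A * B.transpose).det =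
      ∑ c : ι → κ, (A.submatrix id c).det * ((σ.sign : ℤ) * ∏ i, B i (c (σ i))) := by
    rw [h, ← (Equiv.arrowCongr σ.symm (Equiv.refl κ)).sum_comp]
    refine Finset.sum_congr rfl fun c _ ↦ ?_
    have : (A.submatrix id (Equiv.arrowCongr σ.symm (Equiv.refl κ) c)) =
        (A.submatrix id c).submatrix id σ := rfl
    rw [this, Matrix.det_permute']
    simp only [Equiv.arrowCongr_apply, Equiv.symm_symm, Equiv.coe_refl, Function.comp_apply, id]
    ring
  calc _ = ∑ _σ : Equiv.Perm ι, (A * B.transpose).det := by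
        simp [Fintype.card_perm]
    _ = ∑ σ : Equiv.Perm ι, ∑ c : ι → κ,
        (A.submatrix id c).det * ((σ.sign : ℤ) * ∏ i, B i (c (σ i))) :=
        Finset.sum_congr rfl fun σ _ ↦ hσ σ
    _ = _ := by
        rw [Finset.sum_comm]
        refine Finset.sum_congr rfl fun c _ ↦ ?_
        rw [← Finset.mul_sum, ← Matrix.det_transpose (B.submatrix id c),
          Matrix.det_apply' (B.submatrix id c).transpose]
        rfl

theorem mem_span_of_sum_tmul_self_eq {E ι κ : Type*} [AddCommGroup E] [Module ℚ E]
    [Fintype ι] [Fintype κ] (f : ι → E) (w : κ → E) {a b : ℚ} (ha : a ≠ 0)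
    (h : a • ∑ i, f i ⊗ₜ[ℚ] f i = b • ∑ k, w k ⊗ₜ[ℚ] w k) (i : ι) :
    f i ∈ Submodule.span ℚ (Set.range w) := by
  by_contra hi
  obtain ⟨l, hl, hw⟩ := Submodule.exists_le_ker_of_notMem hi
  have hw' (k : κ) : l (w k) = 0 := hw (Submodule.subset_span ⟨k, rfl⟩)
  have h' := congrArg (LinearMap.mul' ℚ ℚ ∘ₗ TensorProduct.map l l) h
  simp only [map_smul, map_sum, LinearMap.comp_apply, TensorProduct.map_tmul,
    LinearMap.mul'_apply, hw', mul_zero, Finset.sum_const_zero, smul_eq_mul,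
    mul_eq_zero, ha, false_or] at h'
  rw [Finset.sum_eq_zero_iff_of_nonneg fun _ _ ↦ mul_self_nonneg _] at h'
  exact hl (mul_self_eq_zero.mp (h' i (Finset.mem_univ i)))

theorem minorsIdeal_eq_span_range {S N M : Type*} [CommRing S] [Fintype N] [DecidableEq N]
    (A : Matrix N M S) :
    minorsIdeal (Fintype.card N) A =
      Ideal.span (Set.range fun c : N → M ↦ (A.submatrix id c).det) := by
  let e := Fintype.equivFin N
  refine le_antisymm (Ideal.span_le.mpr ?_) (Ideal.span_mono ?_)
  · rintro _ ⟨r, c, rfl⟩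
    by_cases hr : Function.Injective r
    · have hr' : Function.Bijective (r ∘ e) :=
        Finite.injective_iff_bijective.mp (hr.comp e.injective)
      have : (A.submatrix r c).det =
          ((A.submatrix id (c ∘ e)).submatrix (Equiv.ofBijective _ hr') id).det := by
        rw [← Matrix.det_submatrix_equiv_self e]
        rfl
      rw [this, Matrix.det_permute]
      exact Ideal.mul_mem_left _ _ (Ideal.subset_span ⟨_, rfl⟩)
    · simp only [Function.Injective, not_forall] at hr
      obtain ⟨i, j, hij, hne⟩ := hr
      rw [Matrix.det_zero_of_row_eq hne (by ext k; simp [hij])]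
      exact zero_mem _
  · rintro _ ⟨c, rfl⟩
    refine ⟨e.symm, c ∘ e.symm, ?_⟩
    dsimp only
    rw [← Matrix.det_submatrix_equiv_self e.symm]
    rfl

section extPowMatrix

variable {S : Type*} [CommRing S] {m n : ℕ} (d : ℕ)

/-- The standard basis of `⋀^d(S^n)`, indexed by the `d`-element subsets of `Fin n`. -/
def extPowBasis (S : Type*) [CommRing S] (n d : ℕ) :
    Module.Basis {s : Finset (Fin n) // s.card = d} S (⋀[S]^d (Fin n → S)) :=
  ((Pi.basisFun S (Fin n)).exteriorPower d).reindex
    (Equiv.subtypeEquivRight fun _ ↦ Set.powersetCard.mem_iff)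

theorem extPowMatrix_eq_toMatrix (A : Matrix (Fin n) (Fin m) S) :
    extPowMatrix d A =
      LinearMap.toMatrix (extPowBasis S m d) (extPowBasis S n d)
        (exteriorPower.map d (Matrix.toLin' A)) := by
  ext s t
  rw [LinearMap.toMatrix_apply, extPowBasis, extPowBasis, Module.Basis.reindex_apply,
    Module.Basis.repr_reindex_apply, exteriorPower.basis_apply,
    exteriorPower.map_apply_ιMulti_family, exteriorPower.basis_repr_apply,
    exteriorPower.ιMulti_family, exteriorPower.ιMultiDual_apply_ιMulti, ← Matrix.det_transpose]
  simp only [extPowMatrix]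
  congr 1
  ext i j
  simp [Set.powersetCard.ofFinEmbEquiv_symm_apply]

theorem extPowMatrix_mul {l : ℕ} (A : Matrix (Fin n) (Fin m) S) (B : Matrix (Fin m) (Fin l) S) :
    extPowMatrix d (A * B) = extPowMatrix d A * extPowMatrix d B := by
  simp only [extPowMatrix_eq_toMatrix]
  rw [Matrix.toLin'_mul, exteriorPower.map_comp, LinearMap.toMatrix_comp (v₂ := extPowBasis S m d)]

theorem extPowMatrix_one : extPowMatrix d (1 : Matrix (Fin n) (Fin n) S) = 1 := by
  rw [extPowMatrix_eq_toMatrix, Matrix.toLin'_one, exteriorPower.map_id, LinearMap.toMatrix_id]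

theorem extPowMatrix_transpose (A : Matrix (Fin n) (Fin m) S) :
    extPowMatrix d A.transpose = (extPowMatrix d A).transpose := by
  ext s t
  exact Matrix.det_transpose _

theorem extPowMatrix_map {S' : Type*} [CommRing S'] (g : S →+* S') (A : Matrix (Fin n) (Fin m) S) :
    extPowMatrix d (A.map g) = (extPowMatrix d A).map g := by
  ext s t
  exact (g.map_det _).symm

theorem extPowMatrix_diagonal (D : Fin n → S) :
    extPowMatrix d (Matrix.diagonal D) = Matrix.diagonal fun s ↦ ∏ i ∈ s.1, D i := by
  have h (A : Matrix (Fin n) (Fin n) S) (s t) : extPowMatrix d (Matrix.diagonal D * A) s t =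
      (∏ i ∈ s.1, D i) * extPowMatrix d A s t := by
    have h1 : ∏ i ∈ s.1, D i = ∏ i, D (s.1.orderEmbOfFin s.2 i) := by
      conv_lhs => rw [← Finset.map_orderEmbOfFin_univ s.1 s.2, Finset.prod_map]
      rfl
    rw [h1]
    simp only [extPowMatrix]
    rw [← Matrix.det_mul_column]
    congr 1
    ext i j
    simp
  ext s t
  rw [← Matrix.mul_one (Matrix.diagonal D), h, extPowMatrix_one, Matrix.diagonal_apply,
    Matrix.one_apply]
  simp


theorem card_filter_mem_subtype_card_eq (hd : 1 ≤ d) (i : Fin n) :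
    (Finset.univ.filter fun s : {s : Finset (Fin n) // s.card = d} ↦ i ∈ s.1).card =
      (n - 1).choose (d - 1) := by
  have h := Finset.card_filter_powersetCard_subset {i} (Finset.univ : Finset (Fin n)) d
    (Finset.subset_univ _) (by simpa using hd)
  simp only [Finset.singleton_subset_iff, Finset.card_univ, Fintype.card_fin,
    Finset.card_singleton] at h
  rw [← h]
  refine Finset.card_bij (fun s _ ↦ s.1) (fun s hs ↦ ?_) (fun s _ t _ h ↦ Subtype.ext h)
    fun s hs ↦ ?_
  · simpa [s.2] using hs
  · simp only [Finset.mem_filter, Finset.mem_powersetCard] at hs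
    exact ⟨⟨s, hs.1.2⟩, by simpa using hs.2, rfl⟩

theorem det_extPowMatrix_diagonal (hd : 1 ≤ d) (D : Fin n → S) :
    (extPowMatrix d (Matrix.diagonal D)).det =
      (Matrix.diagonal D).det ^ (n - 1).choose (d - 1) := by
  rw [extPowMatrix_diagonal, Matrix.det_diagonal, Matrix.det_diagonal, ← Finset.prod_pow]
  have h (s : {s : Finset (Fin n) // s.card = d}) :
      ∏ i ∈ s.1, D i = ∏ i, if i ∈ s.1 then D i else 1 := by simp
  simp only [h]
  rw [Finset.prod_comm]
  refine Finset.prod_congr rfl fun i _ ↦ ?_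
  rw [← Finset.prod_filter, Finset.prod_const, card_filter_mem_subtype_card_eq d hd]

theorem det_extPowMatrix_transvection {K : Type*} [Field K] [CharZero K] {i j : Fin n}
    (hij : i ≠ j) (c : K) : (extPowMatrix d (Matrix.transvection i j c)).det = 1 := by
  have hmul (A B : Matrix (Fin n) (Fin n) K) :
      (extPowMatrix d (A * B)).det = (extPowMatrix d A).det * (extPowMatrix d B).det := by
    rw [extPowMatrix_mul, Matrix.det_mul]
  let D : Fin n → K := Function.update 1 i 2
  have hD : (extPowMatrix d (Matrix.diagonal D)).det ≠ 0 := by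
    rw [extPowMatrix_diagonal, Matrix.det_diagonal]
    refine Finset.prod_ne_zero_iff.mpr fun s _ ↦ Finset.prod_ne_zero_iff.mpr fun k _ ↦ ?_
    by_cases hk : k = i <;> simp [D, hk]
  have hconj : Matrix.diagonal D * Matrix.transvection i j c =
      Matrix.transvection i j c * Matrix.transvection i j c * Matrix.diagonal D := by
    rw [Matrix.transvection_mul_transvection_same _ _ hij]
    ext k l
    rw [Matrix.diagonal_mul, Matrix.mul_diagonal]
    simp only [Matrix.transvection, Matrix.add_apply, Matrix.one_apply, Matrix.single_apply, D,
      Function.update_apply, Pi.one_apply]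
    grind
  have hinv : (extPowMatrix d (Matrix.transvection i j c)).det ≠ 0 := by
    refine left_ne_zero_of_mul (b := (extPowMatrix d (Matrix.transvection i j (-c))).det) ?_
    rw [← hmul, Matrix.transvection_mul_transvection_same _ _ hij, add_neg_cancel,
      Matrix.transvection_zero, extPowMatrix_one, Matrix.det_one]
    exact one_ne_zero
  have h := congrArg (fun M ↦ (extPowMatrix d M).det) hconj
  simp only [hmul] at h
  rw [mul_comm] at h
  exact (mul_right_cancel₀ hinv ((mul_right_cancel₀ hD h).symm.trans (one_mul _).symm))

/-- The Sylvester–Franke theorem. -/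
theorem det_extPowMatrix (hd : 1 ≤ d) (A : Matrix (Fin n) (Fin n) S) :
    (extPowMatrix d A).det = A.det ^ (n - 1).choose (d - 1) := by
  have field_case {K : Type} [Field K] [CharZero K] (M : Matrix (Fin n) (Fin n) K) :
      (extPowMatrix d M).det = M.det ^ (n - 1).choose (d - 1) := by
    refine Matrix.diagonal_transvection_induction
      (fun M ↦ (extPowMatrix d M).det = M.det ^ (n - 1).choose (d - 1)) M
      (fun D _ ↦ det_extPowMatrix_diagonal d hd D) (fun t ↦ ?_) fun A B hA hB ↦ ?_
    · rw [t.det, one_pow]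
      exact det_extPowMatrix_transvection d t.hij t.c
    · rw [extPowMatrix_mul, Matrix.det_mul, Matrix.det_mul, hA, hB, mul_pow]
  let P := MvPolynomial (Fin n × Fin n) ℤ
  let X : Matrix (Fin n) (Fin n) P := Matrix.mvPolynomialX (Fin n) (Fin n) ℤ
  have hX : (extPowMatrix d X).det = X.det ^ (n - 1).choose (d - 1) := by
    apply IsFractionRing.injective P (FractionRing P)
    have : CharZero (FractionRing P) :=
      charZero_of_injective_algebraMap (IsFractionRing.injective P (FractionRing P))
    have h := field_case (X.map (algebraMap P (FractionRing P)))
    rw [extPowMatrix_map] at h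
    rw [map_pow, RingHom.map_det, RingHom.map_det]
    exact h
  let g : P →+* S := (MvPolynomial.aeval fun p : Fin n × Fin n ↦ A p.1 p.2).toRingHom
  have hA : X.map g = A := Matrix.mvPolynomialX_mapMatrix_aeval ℤ A
  have h := congrArg g hX
  rw [map_pow, RingHom.map_det, RingHom.map_det, RingHom.mapMatrix_apply,
    RingHom.mapMatrix_apply, ← extPowMatrix_map, hA] at h
  exact h

end extPowMatrix

theorem map_includeLeft_det_mul_map_includeRight_det {R ι κ : Type*} [CommRing R] [Algebra ℚ R]
    [Fintype ι] [DecidableEq ι] (M : Matrix ι κ R) (c : ι → κ) :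
    ((M.map (Algebra.TensorProduct.includeLeft : R →ₐ[ℚ] R ⊗[ℚ] R)).submatrix id c).det *
      ((M.map (Algebra.TensorProduct.includeRight : R →ₐ[ℚ] R ⊗[ℚ] R)).submatrix id c).det =
      (M.submatrix id c).det ⊗ₜ[ℚ] (M.submatrix id c).det := by
  have hl := AlgHom.map_det (Algebra.TensorProduct.includeLeft : R →ₐ[ℚ] R ⊗[ℚ] R)
    (M.submatrix id c)
  have hr := AlgHom.map_det (Algebra.TensorProduct.includeRight : R →ₐ[ℚ] R ⊗[ℚ] R)
    (M.submatrix id c)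
  calc _ = _ := congrArg₂ (· * ·) hl.symm hr.symm
    _ = _ := by simp

theorem sum_minors_tmul_self {R ι κ : Type*} [CommRing R] [Algebra ℚ R]
    [Fintype ι] [DecidableEq ι] [Fintype κ] (M : Matrix ι κ R) :
    ∑ c : ι → κ, (M.submatrix id c).det ⊗ₜ[ℚ] (M.submatrix id c).det =
      ((Fintype.card ι).factorial : R ⊗[ℚ] R) *
        (M.map (Algebra.TensorProduct.includeLeft : R →ₐ[ℚ] R ⊗[ℚ] R) *
        (M.map (Algebra.TensorProduct.includeRight : R →ₐ[ℚ] R ⊗[ℚ] R)).transpose).det := by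
  rw [factorial_mul_det_mul_transpose]
  exact Finset.sum_congr rfl fun c _ ↦ (map_includeLeft_det_mul_map_includeRight_det M c).symm

theorem sum_prod_minors_tmul_self {R ι κ : Type*} [CommRing R] [Algebra ℚ R]
    [Fintype ι] [DecidableEq ι] [Fintype κ] (M : Matrix ι κ R) (e : ℕ) :
    ∑ c : Fin e → ι → κ,
        (∏ k, (M.submatrix id (c k)).det) ⊗ₜ[ℚ] (∏ k, (M.submatrix id (c k)).det) =
      (((Fintype.card ι).factorial : R ⊗[ℚ] R) *
        (M.map (Algebra.TensorProduct.includeLeft : R →ₐ[ℚ] R ⊗[ℚ] R) *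
        (M.map (Algebra.TensorProduct.includeRight : R →ₐ[ℚ] R ⊗[ℚ] R)).transpose).det) ^ e := by
  classical
  have htmul (x : Fin e → R) : (∏ k, x k) ⊗ₜ[ℚ] (∏ k, x k) = ∏ k, x k ⊗ₜ[ℚ] x k := by
    refine Finset.induction_on Finset.univ (by simp [Algebra.TensorProduct.one_def])
      fun k s hk ih ↦ ?_
    rw [Finset.prod_insert hk, Finset.prod_insert hk, ← ih, Algebra.TensorProduct.tmul_mul_tmul]
  rw [← sum_minors_tmul_self, ← Fin.prod_const, Finset.prod_univ_sum, Fintype.piFinset_univ]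
  exact Finset.sum_congr rfl fun c _ ↦ htmul _

theorem ideal_span_range_pow {R ι : Type*} [CommRing R] (f : ι → R) (e : ℕ) :
    Ideal.span (Set.range f) ^ e = Ideal.span (Set.range fun c : Fin e → ι ↦ ∏ k, f (c k)) := by
  rw [Ideal.span, Submodule.span_pow]
  congr 1
  ext x
  rw [Set.mem_pow]
  simp only [List.prod_ofFn, Set.mem_range]
  constructor
  · rintro ⟨g, rfl⟩
    choose c hc using fun k ↦ (g k).2
    exact ⟨c, by simp [hc]⟩
  · rintro ⟨c, rfl⟩
    exact ⟨fun k ↦ ⟨f (c k), c k, rfl⟩, rfl⟩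

/-- If `R` is a commutative ring containing `ℚ`, `φ : R^m → R^n` a linear map and `1 ≤ d ≤ n`,
then `I(⋀^d(φ)) = I(φ)^e` with `e = (n - 1).choose (d - 1)`. -/
theorem maximalMinors_extPow_eq {R : Type*} [CommRing R] [Algebra ℚ R] {m n : ℕ}
    (φ : Matrix (Fin n) (Fin m) R) (d : ℕ) (hd : 1 ≤ d) (hdn : d ≤ n) :
    minorsIdeal (n.choose d) (extPowMatrix d φ) =
      minorsIdeal n φ ^ ((n - 1).choose (d - 1)) := by
  have hcard : Fintype.card {s : Finset (Fin n) // s.card = d} = n.choose d := by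
    rw [Fintype.card_finset_len, Fintype.card_fin]
  have h1 := minorsIdeal_eq_span_range (extPowMatrix d φ)
  have h2 := minorsIdeal_eq_span_range φ
  rw [hcard] at h1
  rw [Fintype.card_fin] at h2
  rw [h1, h2, ideal_span_range_pow]
  let l : R →+* R ⊗[ℚ] R := (Algebra.TensorProduct.includeLeft : R →ₐ[ℚ] R ⊗[ℚ] R)
  let r : R →+* R ⊗[ℚ] R := (Algebra.TensorProduct.includeRight : R →ₐ[ℚ] R ⊗[ℚ] R)
  have hdet : ((extPowMatrix d φ).map l * ((extPowMatrix d φ).map r).transpose).det =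
      (φ.map l * (φ.map r).transpose).det ^ (n - 1).choose (d - 1) := by
    rw [← extPowMatrix_map, ← extPowMatrix_map, ← extPowMatrix_transpose, ← extPowMatrix_mul,
      det_extPowMatrix d hd]
  have hf := sum_minors_tmul_self (extPowMatrix d φ)
  have hw := sum_prod_minors_tmul_self φ ((n - 1).choose (d - 1))
  have key : ((n.factorial ^ (n - 1).choose (d - 1) : ℕ) : ℚ) •
        ∑ c, ((extPowMatrix d φ).submatrix id c).det ⊗ₜ[ℚ]
          ((extPowMatrix d φ).submatrix id c).det =
      ((n.choose d).factorial : ℚ) • ∑ c : Fin ((n - 1).choose (d - 1)) → Fin n → Fin m,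
        (∏ k, (φ.submatrix id (c k)).det) ⊗ₜ[ℚ] (∏ k, (φ.submatrix id (c k)).det) := by
    rw [hf, hw, mul_pow, hcard, Fintype.card_fin, Nat.cast_smul_eq_nsmul, Nat.cast_smul_eq_nsmul,
      nsmul_eq_mul, nsmul_eq_mul, Nat.cast_pow]
    refine Eq.trans (congrArg (fun x ↦ _ * (_ * x)) hdet) ?_
    exact mul_left_comm _ _ _
  have hle {ι κ : Type} (f : ι → R) (w : κ → R)
      (h : ∀ i, f i ∈ Submodule.span ℚ (Set.range w)) :
      Ideal.span (Set.range f) ≤ Ideal.span (Set.range w) := by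
    rw [Ideal.span_le]
    rintro _ ⟨i, rfl⟩
    exact Submodule.span_subset_span ℚ R _ (h i)
  exact le_antisymm
    (hle _ _ (mem_span_of_sum_tmul_self_eq _ _
      (Nat.cast_ne_zero.mpr (pow_ne_zero _ n.factorial_ne_zero)) key))
    (hle _ _ (mem_span_of_sum_tmul_self_eq _ _
      (Nat.cast_ne_zero.mpr (Nat.factorial_ne_zero _)) key.symm))
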